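/- Let λ, t₁, t₂, t₃ be real numbers with |t₁| ≥ |t₂| ≥ |t₃|, and let M be the real 3×4 matrix whose 0-th column is the zero vector and whose remaining 3×3 block is (λ/2)·diag(t₁, t₂, t₃). Then the minimum of ‖M − P·M‖₂² over all real 3×3 orthogonal projection matrices P of rank 1 equals (λ²/4)·(t₂² + t₃²). -/

import Mathlib

open Matrix

/-- The `A`-correlation matrix `𝒯^A` of the state `ρ = λ ρ_BD + (1-λ) ρ_p`:
zero coherence-vector column followed by the correlation matrix `(λ/2)·diag(t₁,t₂,t₃)`. -/
noncomputable def corrMatA (l t₁ t₂ t₃ : ℝ) : Matrix (Fin 3) (Fin 4) ℝ :=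
  (1 / 2 : ℝ) • !![0, l * t₁, 0, 0; 0, 0, l * t₂, 0; 0, 0, 0, l * t₃]

/-- The trace of an idempotent matrix over a field is its rank. -/
theorem trace_eq_rank_of_isIdempotentElem {n K : Type*} [Fintype n] [DecidableEq n] [Field K]
    {P : Matrix n n K} (hP : IsIdempotentElem P) : P.trace = (P.rank : K) := by
  have h : IsIdempotentElem (toLin' P) := by
    rw [IsIdempotentElem, Module.End.mul_eq_comp, ← toLin'_mul, hP.eq]
  rw [← trace_toLin'_eq, (LinearMap.IsIdempotentElem.isProj_range _ h).trace]
  rfl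

/-- The squared Frobenius distance from `M` to its image under an orthogonal projection. -/
theorem trace_sub_proj_mul_transpose {m n R : Type*} [Fintype m] [Fintype n] [CommRing R]
    {P : Matrix m m R} (hT : Pᵀ = P) (hP : P * P = P) (M : Matrix m n R) :
    ((M - P * M) * (M - P * M)ᵀ).trace = (M * Mᵀ).trace - (P * (M * Mᵀ)).trace := by
  have h₁ : (M * (Mᵀ * P)).trace = (P * (M * Mᵀ)).trace := by
    rw [← Matrix.mul_assoc, trace_mul_comm]
  have h₂ : (P * M * (Mᵀ * P)).trace = (P * (M * Mᵀ)).trace := by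
    rw [← Matrix.mul_assoc, trace_mul_comm, ← Matrix.mul_assoc, ← Matrix.mul_assoc, hP,
      Matrix.mul_assoc]
  rw [transpose_sub, transpose_mul, hT, Matrix.sub_mul, Matrix.mul_sub, Matrix.mul_sub,
    trace_sub, trace_sub, trace_sub, h₁, h₂, Matrix.mul_assoc]
  ring

theorem diag_nonneg_of_isSymm_of_mul_self {n : Type*} [Fintype n] {P : Matrix n n ℝ}
    (hT : Pᵀ = P) (hP : P * P = P) (i : n) : 0 ≤ P i i := by
  have h : P i i = ∑ j, P i j * P i j := by
    conv_lhs => rw [← hP]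
    exact Finset.sum_congr rfl fun j _ => congrArg (P i j * ·) (congrFun (congrFun hT i) j)
  rw [h]
  exact Finset.sum_nonneg fun j _ => mul_self_nonneg _

theorem corrMatA_mul_transpose (l t₁ t₂ t₃ : ℝ) :
    corrMatA l t₁ t₂ t₃ * (corrMatA l t₁ t₂ t₃)ᵀ =
      diagonal ![l ^ 2 / 4 * t₁ ^ 2, l ^ 2 / 4 * t₂ ^ 2, l ^ 2 / 4 * t₃ ^ 2] := by
  ext i j
  fin_cases i <;> fin_cases j <;>
    simp [corrMatA, Matrix.mul_apply, Fin.sum_univ_succ] <;> ring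

/-- The squared Frobenius distance in terms of the diagonal entries of the projection. -/
theorem trace_corrMatA_sub_proj (l t₁ t₂ t₃ : ℝ) {P : Matrix (Fin 3) (Fin 3) ℝ}
    (hT : Pᵀ = P) (hP : P * P = P) :
    ((corrMatA l t₁ t₂ t₃ - P * corrMatA l t₁ t₂ t₃) *
        (corrMatA l t₁ t₂ t₃ - P * corrMatA l t₁ t₂ t₃)ᵀ).trace =
      l ^ 2 / 4 * (t₁ ^ 2 * (1 - P 0 0) + t₂ ^ 2 * (1 - P 1 1) + t₃ ^ 2 * (1 - P 2 2)) := by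
  rw [trace_sub_proj_mul_transpose hT hP, corrMatA_mul_transpose]
  simp only [trace_fin_three, mul_diagonal, diagonal_apply_eq, cons_val]
  ring

/-- For `|t₁| ≥ |t₂| ≥ |t₃|`, the minimum of `‖M - P * M‖₂²` over rank-1 orthogonal
projections `P`, where `M = corrMatA l t₁ t₂ t₃`, equals `(λ²/4)(t₂² + t₃²)`. -/
theorem qa_bell_diagonal_mixture (l t₁ t₂ t₃ : ℝ)
    (h12 : |t₂| ≤ |t₁|) (h23 : |t₃| ≤ |t₂|) :
    IsLeast {x : ℝ | ∃ P : Matrix (Fin 3) (Fin 3) ℝ, Pᵀ = P ∧ P * P = P ∧ P.rank = 1 ∧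
        x = ((corrMatA l t₁ t₂ t₃ - P * corrMatA l t₁ t₂ t₃) *
              (corrMatA l t₁ t₂ t₃ - P * corrMatA l t₁ t₂ t₃)ᵀ).trace}
      (l ^ 2 / 4 * (t₂ ^ 2 + t₃ ^ 2)) := by
  constructor
  · have hT : (diagonal ![1, 0, 0] : Matrix (Fin 3) (Fin 3) ℝ)ᵀ = diagonal ![1, 0, 0] :=
      diagonal_transpose _
    have hP : (diagonal ![1, 0, 0] : Matrix (Fin 3) (Fin 3) ℝ) * diagonal ![1, 0, 0] =
        diagonal ![1, 0, 0] := by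
      rw [diagonal_mul_diagonal]
      congr 1
      ext i
      fin_cases i <;> simp
    refine ⟨diagonal ![1, 0, 0], hT, hP, ?_, ?_⟩
    · have h := trace_eq_rank_of_isIdempotentElem hP
      rw [trace_fin_three] at h
      simp only [diagonal_apply_eq, cons_val, add_zero] at h
      exact_mod_cast h.symm
    · rw [trace_corrMatA_sub_proj l t₁ t₂ t₃ hT hP]
      simp only [diagonal_apply_eq, cons_val]
      ring
  · rintro x ⟨P, hT, hP, hr, rfl⟩
    have htr := trace_eq_rank_of_isIdempotentElem hP
    rw [hr, Nat.cast_one, trace_fin_three] at htr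
    have h₁ := diag_nonneg_of_isSymm_of_mul_self hT hP 1
    have h₂ := diag_nonneg_of_isSymm_of_mul_self hT hP 2
    have hs₁₂ := sq_le_sq.mpr h12
    have hs₁₃ := sq_le_sq.mpr (h23.trans h12)
    rw [trace_corrMatA_sub_proj l t₁ t₂ t₃ hT hP,
      show P 0 0 = 1 - P 1 1 - P 2 2 by linarith]
    refine mul_le_mul_of_nonneg_left ?_ (by positivity)
    nlinarith [mul_nonneg h₁ (sub_nonneg.mpr hs₁₂), mul_nonneg h₂ (sub_nonneg.mpr hs₁₃)]
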